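/- arXiv:1704.00062 — 2 statements merged into one kernel-verified Lean document; each statement's English description precedes it below -/
import Mathlib

section
/- Let F be a number field, O_F its ring of integers, and d_F its discriminant. Then the module of Kähler differentials Ω_{O_F/ℤ} is a finite abelian group whose order equals |d_F|. -/
open NumberField Polynomial

/-- Away from the conductor of `R[x]`, the differentials of `B` are generated by `dx`. -/
theorem smul_kaehlerDifferential_mem_span_D {R B : Type*} [CommRing R] [CommRing B] [Algebra R B]
    {x s : B} (hs : s ∈ conductor R x) (m : Ω[B⁄R]) :
    s • m ∈ Submodule.span B {KaehlerDifferential.D R B x} := by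
  have hD {b : B} (hb : b ∈ Algebra.adjoin R {x}) :
      KaehlerDifferential.D R B b ∈ Submodule.span B {KaehlerDifferential.D R B x} := by
    rw [Algebra.adjoin_singleton_eq_range_aeval, AlgHom.mem_range] at hb
    obtain ⟨g, rfl⟩ := hb
    rw [Derivation.map_aeval]
    exact Submodule.smul_mem _ _ (Submodule.mem_span_singleton_self _)
  have hm : m ∈ Submodule.span B (Set.range (KaehlerDifferential.D R B)) := by
    rw [KaehlerDifferential.span_range_derivation]
    trivial
  induction hm using Submodule.span_induction with
  | mem m hm =>
    obtain ⟨b, rfl⟩ := hm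
    have h := (KaehlerDifferential.D R B).leibniz s b
    rw [eq_comm, ← eq_sub_iff_add_eq] at h
    rw [h]
    exact sub_mem (hD (mem_conductor_iff.mp hs b))
      (Submodule.smul_mem _ _ (hD (conductor_subset_adjoin hs)))
  | zero => simp
  | add m n _ _ hm hn => rw [smul_add]; exact add_mem hm hn
  | smul b m _ hm => rw [smul_comm]; exact Submodule.smul_mem _ _ hm

section Monogenic

variable {R B : Type*} [CommRing R] [IsDomain R] [IsIntegrallyClosed R] [CommRing B] [IsDomain B]
  [Algebra R B] [Module.IsTorsionFree R B]

/-- Formal derivatives of polynomials taking the same value at an integral element `x` take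
congruent values at `x` modulo the derivative of the minimal polynomial. -/
theorem mk_aeval_derivative_eq_of_aeval_eq {x : B} (hx : IsIntegral R x) {g h : R[X]}
    (hgh : aeval x g = aeval x h) :
    Ideal.Quotient.mk (Ideal.span {aeval x (derivative (minpoly R x))})
      (aeval x (derivative g)) = Ideal.Quotient.mk _ (aeval x (derivative h)) := by
  obtain ⟨k, hk⟩ := minpoly.isIntegrallyClosed_dvd hx (p := g - h) (by simp [hgh])
  rw [Ideal.Quotient.eq, ← map_sub, ← derivative_sub, hk, derivative_mul, map_add, map_mul,
    map_mul, minpoly.aeval, zero_mul, add_zero]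
  exact Ideal.mul_mem_right _ _ (Ideal.mem_span_singleton_self _)

/-- On `B`, the multiple `s ^ 2 • d/dx` of the derivation `d/dx` of `R[x]` is defined for every `s`
in the conductor of `R[x]`. -/
theorem exists_derivation_apply_eq_sq {x : B} (hx : IsIntegral R x) {s : B}
    (hs : s ∈ conductor R x) :
    ∃ d : Derivation R B (B ⧸ Ideal.span {aeval x (derivative (minpoly R x))}),
      d x = Ideal.Quotient.mk _ (s ^ 2) := by
  have key := fun b ↦ mem_conductor_iff.mp hs b
  simp only [Algebra.adjoin_singleton_eq_range_aeval, AlgHom.mem_range] at key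
  choose G hG using key
  set I := Ideal.span {aeval x (derivative (minpoly R x))}
  let E : R[X] → B ⧸ I := fun g ↦ Ideal.Quotient.mk I (aeval x (derivative g))
  have hE {g h : R[X]} (hgh : aeval x g = aeval x h) : E g = E h :=
    mk_aeval_derivative_eq_of_aeval_eq hx hgh
  have E_add (g h : R[X]) : E (g + h) = E g + E h := by simp [E]
  have E_smul (r : R) (g : R[X]) : E (r • g) = r • E g := by
    simp only [E, map_smul]
    rfl
  have E_mul (g h : R[X]) : E (g * h) = aeval x g • E h + aeval x h • E g := by
    simp only [E, derivative_mul, map_add, map_mul, Algebra.smul_def, Ideal.Quotient.algebraMap_eq]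
    ring
  let φ : B →ₗ[R] B ⧸ I :=
    { toFun := fun b ↦ s • E (G b) - b • s • E (G 1)
      map_add' := fun b c ↦ by
        rw [hE (g := G (b + c)) (h := G b + G c) (by simp only [map_add, hG]; ring), E_add]
        module
      map_smul' := fun r b ↦ by
        rw [hE (g := G (r • b)) (h := r • G b) (by simp only [map_smul, hG, mul_smul_comm]),
          E_smul, RingHom.id_apply, smul_sub, smul_comm s r, smul_assoc r b] }
  have φ_apply (b : B) : φ b = s • E (G b) - b • s • E (G 1) := rfl
  refine ⟨Derivation.mk' φ fun b c ↦ ?_, ?_⟩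
  · have h := hE (g := G 1 * G (b * c)) (h := G b * G c) (by simp only [map_mul, hG]; ring)
    simp only [E_mul, hG] at h
    simp only [φ_apply]
    linear_combination (norm := skip) h
    module
  · have h := hE (g := G x) (h := G 1 * X) (by simp [hG])
    have hX : E X = Ideal.Quotient.mk I 1 := by simp [E]
    rw [Derivation.coe_mk', φ_apply, h, E_mul, hX]
    simp only [hG, aeval_X, Algebra.smul_def, Ideal.Quotient.algebraMap_eq, map_mul, map_one,
      map_pow]
    ring

/-- Away from the conductor of `R[x]`, the annihilator of `dx` is generated by the derivative of the
minimal polynomial of `x`. -/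
theorem mul_sq_mem_span_of_smul_D_eq_zero {x : B} (hx : IsIntegral R x) {s : B}
    (hs : s ∈ conductor R x) {a : B} (ha : a • KaehlerDifferential.D R B x = 0) :
    a * s ^ 2 ∈ Ideal.span {aeval x (derivative (minpoly R x))} := by
  obtain ⟨d, hd⟩ := exists_derivation_apply_eq_sq hx hs
  have h := congr_arg d.liftKaehlerDifferential ha
  rwa [map_zero, map_smul, Derivation.liftKaehlerDifferential_comp_D, hd, Algebra.smul_def,
    Ideal.Quotient.algebraMap_eq, ← map_mul, Ideal.Quotient.eq_zero_iff_mem] at h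

end Monogenic

section LocalGenerator

variable {R B : Type*} [CommRing R] [CommRing B] [Algebra R B]

/-- If `x` is a unit modulo `P` and `x B ⊆ R[x] + a B` for some `a ∈ P`, then the conductor of
`R[x]` is not contained in `P`. -/
theorem exists_mem_conductor_notMem [Module.Finite R B] {P : Ideal B} (hP : P ≠ ⊤) {x : B} {n : ℕ}
    (hx : x ^ (n + 1) - 1 ∈ P) {a : R} (ha : algebraMap R B a ∈ P)
    (h : ∀ b, ∃ y ∈ Algebra.adjoin R {x}, ∃ c, x * b = y + algebraMap R B a * c) :
    ∃ s ∈ conductor R x, s ∉ P := by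
  let A := Algebra.adjoin R {x}
  let x' : A := ⟨x, Algebra.self_mem_adjoin_singleton R x⟩
  let 𝔭 : Ideal A := P.comap (algebraMap A B)
  have : Module.Finite A B := Module.Finite.of_restrictScalars_finite R A B
  let N : Submodule A B := 1
  have hN (y : A) : (y : B) ∈ N := Submodule.mem_one.mpr ⟨y, rfl⟩
  have hle : (⊤ : Submodule A B) ≤ N ⊔ 𝔭 • ⊤ := by
    intro b _
    obtain ⟨y, hy, c, hc⟩ := h b
    have hb : b = (x' ^ n * ⟨y, hy⟩ : A) +
        ((algebraMap R A a) • (x ^ n * c) - (x' ^ (n + 1) - 1) • b) := by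
      simp only [Algebra.smul_def, map_sub, map_pow, map_one, ← IsScalarTower.algebraMap_apply]
      change b = x ^ n * y + (algebraMap R B a * (x ^ n * c) - (x ^ (n + 1) - 1) * b)
      linear_combination x ^ n * hc
    rw [hb]
    refine Submodule.add_mem_sup (hN _) (sub_mem ?_ ?_)
    · refine Submodule.smul_mem_smul ?_ trivial
      rwa [Ideal.mem_comap, ← IsScalarTower.algebraMap_apply]
    · refine Submodule.smul_mem_smul ?_ trivial
      simpa [𝔭, x'] using! hx
  obtain ⟨r, hr, hrN⟩ := Submodule.exists_sub_one_mem_and_smul_le_of_fg_of_le_sup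
    Module.Finite.fg_top le_rfl hle
  refine ⟨r, fun b ↦ ?_, fun hrP ↦ hP ?_⟩
  · obtain ⟨y, hy⟩ := Submodule.mem_one.mp
      (hrN (Submodule.smul_mem_pointwise_smul b r _ trivial))
    rw [Algebra.smul_def] at hy
    exact hy ▸ y.2
  · rw [Ideal.eq_top_iff_one]
    have h1 : (r : B) - 1 ∈ P := by simpa [𝔭] using! hr
    simpa using sub_mem hrP h1

/-- If a subring surjects onto `B ⧸ P` and contains a generator of `P` modulo `P ^ 2`, then it
surjects onto every `B ⧸ P ^ k`. -/
theorem exists_sub_mem_pow_of_uniformizer [IsDedekindDomain B] {P : Ideal B} [P.IsMaximal]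
    (A : Subalgebra R B) (h : ∀ b, ∃ y ∈ A, b - y ∈ P) {t : B} (htA : t ∈ A) (htP : t ∈ P)
    (htP2 : t ∉ P ^ 2) (k : ℕ) (b : B) : ∃ y ∈ A, b - y ∈ P ^ k := by
  induction k with
  | zero => exact ⟨0, zero_mem _, by simp⟩
  | succ k ih =>
    obtain ⟨y, hy, hyb⟩ := ih
    have h0 : P ≠ ⊥ := fun h0 ↦ htP2 (by rw [h0, Ideal.mem_bot] at htP; simp [htP])
    have hk : t ^ k ∈ P ^ k := Ideal.pow_mem_pow htP k
    have hk' : t ^ k ∉ P ^ (k + 1) := by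
      have hPp : Prime P := Ideal.prime_of_isPrime h0 inferInstance
      obtain ⟨K, hK⟩ := Ideal.dvd_span_singleton.mpr htP
      rw [← Ideal.dvd_span_singleton, ← Ideal.span_singleton_pow, hK, mul_pow, pow_succ]
      refine fun hdvd ↦ htP2 ?_
      have hPK := hPp.dvd_of_dvd_pow
        ((mul_dvd_mul_iff_left (pow_ne_zero k hPp.ne_zero)).mp hdvd)
      rw [← Ideal.dvd_span_singleton, hK, sq]
      exact mul_dvd_mul_left P hPK
    obtain ⟨d, e, he, hde⟩ := Ideal.exists_mul_add_mem_pow_succ h0 _ _ hk hk' hyb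
    obtain ⟨z, hz, hzd⟩ := h d
    refine ⟨y + t ^ k * z, add_mem hy (mul_mem (pow_mem htA k) hz), ?_⟩
    have : b - (y + t ^ k * z) = t ^ k * (d - z) + e := by linear_combination -hde
    rw [this]
    refine add_mem ?_ he
    rw [pow_succ P k]
    exact Ideal.mul_mem_mul hk hzd

theorem exists_generator_quotient_pow_sub_notMem_sq [IsDedekindDomain B] {P : Ideal B}
    [P.IsMaximal] (hP : P ≠ ⊥) [Finite (B ⧸ P)] :
    ∃ x : B, (∀ b, b ∈ P ∨ ∃ n, b - x ^ n ∈ P) ∧ x ∉ P ∧ x ^ Nat.card (B ⧸ P) - x ∉ P ^ 2 := by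
  let := Ideal.Quotient.field P
  have : Fintype (B ⧸ P) := Fintype.ofFinite _
  obtain ⟨u, hu⟩ := IsCyclic.exists_generator (α := (B ⧸ P)ˣ)
  obtain ⟨x, hx⟩ := Ideal.Quotient.mk_surjective (u : B ⧸ P)
  have gen {y : B} (hy : Ideal.Quotient.mk P y = u) :
      (∀ b, b ∈ P ∨ ∃ n, b - y ^ n ∈ P) ∧ y ∉ P := by
    refine ⟨fun b ↦ or_iff_not_imp_left.mpr fun hb ↦ ?_, fun hyP ↦ u.ne_zero ?_⟩
    · rw [← Ideal.Quotient.eq_zero_iff_mem] at hb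
      obtain ⟨n, hn⟩ := (mem_powers_iff_mem_zpowers).mpr (hu (Units.mk0 _ hb))
      refine ⟨n, Ideal.Quotient.eq.mp ?_⟩
      rw [map_pow, hy, ← Units.val_pow_eq_pow_val]
      exact (congr_arg Units.val hn).symm
    · rw [← hy, Ideal.Quotient.eq_zero_iff_mem.mpr hyP]
  by_cases h : x ^ Nat.card (B ⧸ P) - x ∈ P ^ 2
  · obtain ⟨t, ht, ht2⟩ := Ideal.exists_mem_pow_notMem_pow_succ P hP (Ideal.IsPrime.ne_top') 1
    rw [pow_one] at ht
    obtain ⟨h1, h2⟩ := gen (y := x + t) (by rw [map_add, hx, Ideal.Quotient.eq_zero_iff_mem.mpr ht,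
      add_zero])
    refine ⟨x + t, h1, h2, fun h3 ↦ ht2 ?_⟩
    obtain ⟨k, hk⟩ := Polynomial.powAddExpansion x t (Nat.card (B ⧸ P))
    have hq : (Nat.card (B ⧸ P) : B) ∈ P := by
      rw [← Ideal.Quotient.eq_zero_iff_mem, map_natCast]
      rw [Nat.card_eq_fintype_card]
      exact FiniteField.cast_card_eq_zero _
    have h4 : (Nat.card (B ⧸ P) : B) * t ∈ P ^ 2 := by
      rw [sq]
      exact Ideal.mul_mem_mul hq ht
    have : t = (x ^ Nat.card (B ⧸ P) - x) + x ^ (Nat.card (B ⧸ P) - 1) *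
        ((Nat.card (B ⧸ P) : B) * t) + k * t ^ 2 - ((x + t) ^ Nat.card (B ⧸ P) - (x + t)) := by
      linear_combination hk
    rw [this]
    exact sub_mem (add_mem (add_mem h (Ideal.mul_mem_left _ _ h4))
      (Ideal.mul_mem_left _ _ (Ideal.pow_mem_pow ht 2))) h3
  · exact ⟨x, (gen hx).1, (gen hx).2, h⟩

/-- In a Dedekind domain finite over `R`, every maximal ideal with finite residue field lying over
a nonzero element of `R` is prime to the conductor of some `R[x]`. -/
theorem exists_conductor_not_le [IsDedekindDomain B] [Module.Finite R B] (P : Ideal B)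
    [P.IsMaximal] [Finite (B ⧸ P)] {a : R} (ha0 : algebraMap R B a ≠ 0)
    (ha : algebraMap R B a ∈ P) :
    ∃ x : B, ∃ s ∈ conductor R x, s ∉ P := by
  have hP : P ≠ ⊥ := fun h ↦ ha0 (by simpa [h] using ha)
  have hPp : Prime P := Ideal.prime_of_isPrime hP inferInstance
  obtain ⟨x₀, hgen, hx₀, hx₀2⟩ := exists_generator_quotient_pow_sub_notMem_sq hP
  set q := Nat.card (B ⧸ P)
  obtain ⟨J, hJ, hPJ⟩ := (FiniteMultiplicity.of_prime_left hPp
    (b := Ideal.span {algebraMap R B a}) (by simpa using ha0)).exists_eq_pow_mul_and_not_dvd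
  set e := multiplicity P (Ideal.span {algebraMap R B a})
  have hcop : IsCoprime (P ^ 2) J := by
    refine IsCoprime.pow_left ?_
    rw [Ideal.isCoprime_iff_sup_eq]
    exact Ideal.IsMaximal.out.2 _
      (left_lt_sup.mpr fun hJP ↦ hPJ (Ideal.dvd_iff_le.mpr hJP))
  obtain ⟨x, hx⟩ : ∃ x, x - x₀ ∈ P ^ 2 ∧ x ∈ J := by
    obtain ⟨i, hi, j, hj, hij⟩ := Ideal.isCoprime_iff_exists.mp hcop
    refine ⟨x₀ * j, ?_, Ideal.mul_mem_left _ _ hj⟩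
    have : x₀ * j - x₀ = - x₀ * i := by linear_combination x₀ * hij
    rw [this]
    exact Ideal.mul_mem_left _ _ hi
  obtain ⟨hxx₀, hxJ⟩ := hx
  have hxx₀P : x - x₀ ∈ P := Ideal.pow_le_self two_ne_zero hxx₀
  have hpow {I : Ideal B} (hI : x - x₀ ∈ I) (n : ℕ) : x ^ n - x₀ ^ n ∈ I :=
    I.mem_of_dvd (sub_dvd_pow_sub_pow x x₀ n) hI
  have hxgen (b : B) (hb : b ∉ P) : ∃ n, b - x ^ n ∈ P := by
    obtain ⟨n, hn⟩ := (hgen b).resolve_left hb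
    refine ⟨n, ?_⟩
    simpa using sub_mem hn (hpow hxx₀P n)
  have hxP : x ∉ P := fun h ↦ hx₀ (by simpa using sub_mem h hxx₀P)
  obtain ⟨n, hn⟩ : ∃ n, x ^ (n + 1) - 1 ∈ P := by
    obtain ⟨y, i, hi, hy⟩ := Ideal.IsMaximal.exists_inv ‹P.IsMaximal› hxP
    have hyP : y ∉ P := fun h ↦ ‹P.IsMaximal›.isPrime.one_notMem
      (hy ▸ add_mem (Ideal.mul_mem_right _ _ h) hi)
    obtain ⟨n, hn⟩ := hxgen y hyP
    refine ⟨n, ?_⟩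
    have : x ^ (n + 1) - 1 = -(x * (y - x ^ n)) - i := by linear_combination hy
    rw [this]
    exact sub_mem (neg_mem (Ideal.mul_mem_left _ _ hn)) hi
  let A := Algebra.adjoin R {x}
  have hxA : x ∈ A := Algebra.self_mem_adjoin_singleton R x
  have hres (b : B) : ∃ y ∈ A, b - y ∈ P := by
    by_cases hb : b ∈ P
    · exact ⟨0, zero_mem _, by simpa using hb⟩
    · obtain ⟨m, hm⟩ := hxgen b hb
      exact ⟨x ^ m, pow_mem hxA m, hm⟩
  have htP : x ^ q - x ∈ P := by
    let := Ideal.Quotient.field P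
    have : Fintype (B ⧸ P) := Fintype.ofFinite _
    rw [← Ideal.Quotient.eq, map_pow, show q = Fintype.card (B ⧸ P) from Nat.card_eq_fintype_card]
    exact FiniteField.pow_card _
  have htP2 : x ^ q - x ∉ P ^ 2 := fun h ↦ hx₀2 <| by
    have : x₀ ^ q - x₀ = x ^ q - x - ((x ^ q - x₀ ^ q) - (x - x₀)) := by ring
    rw [this]
    exact sub_mem h (sub_mem (hpow hxx₀ q) hxx₀)
  refine ⟨x, exists_mem_conductor_notMem Ideal.IsPrime.ne_top' hn ha fun b ↦ ?_⟩
  obtain ⟨y, hy, hyb⟩ := exists_sub_mem_pow_of_uniformizer A hres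
    (sub_mem (pow_mem hxA q) hxA) htP htP2 e b
  have hmem : (b - y) * x ∈ Ideal.span {algebraMap R B a} := hJ ▸ Ideal.mul_mem_mul hyb hxJ
  obtain ⟨c, hc⟩ := Ideal.mem_span_singleton'.mp hmem
  exact ⟨x * y, mul_mem hxA hy, c, by linear_combination -hc⟩

end LocalGenerator

/-- A finite module over a Dedekind domain which is generated away from each maximal ideal by one
element with annihilator `I` is isomorphic to `B ⧸ I`. -/
theorem nonempty_linearEquiv_quotient_of_locally_cyclic {B M : Type*} [CommRing B]
    [IsDedekindDomain B] [AddCommGroup M] [Module B M] [Module.Finite B M] {I : Ideal B}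
    (hI : I ≠ ⊥)
    (h : ∀ P : Ideal B, P.IsMaximal → ∃ s ∉ P, ∃ w : M, (∀ m, s • m ∈ Submodule.span B {w}) ∧
      (∀ a ∈ I, a • w = 0) ∧ ∀ a, a • w = 0 → s * a ∈ I) :
    Nonempty (M ≃ₗ[B] B ⧸ I) := by
  classical
  choose! s hs w hw hIw hann using h
  have eq_top (J : Ideal B) (hJ : ∀ P : Ideal B, P.IsMaximal → ∃ r ∈ J, r ∉ P) : J = ⊤ := by
    by_contra hne
    obtain ⟨P, hP, hJP⟩ := Ideal.exists_le_maximal J hne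
    obtain ⟨r, hr, hrP⟩ := hJ P hP
    exact hrP (hJP hr)
  have hIM (a : B) (ha : a ∈ I) (m : M) : a • m = 0 := by
    have := eq_top (Submodule.span B {a • m}).annihilator fun P hP ↦ ⟨s P, ?_, hs P hP⟩
    · rw [Submodule.annihilator_eq_top_iff, Submodule.span_singleton_eq_bot] at this
      exact this
    · rw [Submodule.mem_annihilator_span_singleton]
      obtain ⟨b, hb⟩ := Submodule.mem_span_singleton.mp (hw P hP m)
      rw [smul_comm, ← hb, smul_comm, hIw P hP a ha, smul_zero]
  have hfin : {P : Ideal B | P.IsMaximal ∧ I ≤ P}.Finite := by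
    refine (Ideal.finite_factors hI).image (fun v ↦ v.asIdeal) |>.subset ?_
    rintro P ⟨hP, hIP⟩
    have hP0 : P ≠ ⊥ := fun h ↦ hI (by rwa [h, le_bot_iff] at hIP)
    exact ⟨⟨P, hP.isPrime, hP0⟩, Ideal.dvd_iff_le.mpr hIP, rfl⟩
  have := hfin.to_subtype
  let T := {P : Ideal B | P.IsMaximal ∧ I ≤ P}
  have : Fintype T := Fintype.ofFinite T
  have hcop : Pairwise (Function.onFun IsCoprime fun P : T ↦ (P : Ideal B)) := fun P Q hPQ ↦
    Ideal.isCoprime_iff_sup_eq.mpr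
      (P.2.1.coprime_of_ne Q.2.1 fun h ↦ hPQ (Subtype.ext h))
  choose e he using fun P : T ↦
    Ideal.exists_forall_sub_mem_ideal hcop (Pi.single (M := fun _ ↦ B) P 1)
  let v : M := ∑ P : T, e P • w P
  have hv : Submodule.span B {v} = ⊤ := by
    have hwv (P : T) : w P ∈ Submodule.span B {v} ⊔ (P : Ideal B) • (⊤ : Submodule B M) := by
      have hsplit : w P = v - ∑ Q : T, (e Q - Pi.single (M := fun _ ↦ B) Q 1 P) • w Q := by
        simp [v, sub_smul, Finset.sum_sub_distrib, Pi.single_apply]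
      rw [hsplit]
      refine sub_mem (Submodule.mem_sup_left (Submodule.mem_span_singleton_self v))
        (Submodule.mem_sup_right (sum_mem fun Q _ ↦
          Submodule.smul_mem_smul (he Q P) trivial))
    have := eq_top (Submodule.colon (Submodule.span B {v}) Set.univ) fun P hP ↦ ?_
    · rw [eq_top_iff]
      intro m _
      simpa using Submodule.mem_colon.mp ((Ideal.eq_top_iff_one _).mp this) m trivial
    · have hle : (⊤ : Submodule B M) ≤ Submodule.span B {v} ⊔ P • ⊤ := by
        intro m _
        by_cases hIP : I ≤ P
        · obtain ⟨y, i, hi, hy⟩ := hP.exists_inv (hs P hP)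
          have hm : m = y • s P • m + i • m := by rw [← mul_smul, ← add_smul, hy, one_smul]
          rw [hm]
          refine add_mem (Submodule.smul_mem _ _ ?_)
            (Submodule.mem_sup_right (Submodule.smul_mem_smul hi trivial))
          exact (Submodule.span_singleton_le_iff_mem _ _).mpr (hwv ⟨P, hP, hIP⟩) (hw P hP m)
        · obtain ⟨a, ha, haP⟩ := Set.not_subset.mp hIP
          obtain ⟨y, i, hi, hy⟩ := hP.exists_inv haP
          have hm : m = y • a • m + i • m := by rw [← mul_smul, ← add_smul, hy, one_smul]
          rw [hm, hIM a ha, smul_zero, zero_add]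
          exact Submodule.mem_sup_right (Submodule.smul_mem_smul hi trivial)
      obtain ⟨r, hr, hrv⟩ := Submodule.exists_sub_one_mem_and_smul_le_of_fg_of_le_sup
        Module.Finite.fg_top le_rfl hle
      refine ⟨r, Submodule.mem_colon.mpr fun m _ ↦
        hrv (Submodule.smul_mem_pointwise_smul m r _ trivial), fun hrP ↦ ?_⟩
      exact hP.ne_top ((Ideal.eq_top_iff_one _).mpr (by simpa using sub_mem hrP hr))
  have hker : LinearMap.ker (LinearMap.toSpanSingleton B M v) = I := by
    ext a
    rw [LinearMap.mem_ker, LinearMap.toSpanSingleton_apply]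
    refine ⟨fun ha ↦ ?_, fun ha ↦ hIM a ha v⟩
    have haM (m : M) : a • m = 0 := by
      obtain ⟨b, rfl⟩ := Submodule.mem_span_singleton.mp (hv ▸ Submodule.mem_top (x := m))
      rw [smul_comm, ha, smul_zero]
    have := eq_top (I.colon {a}) fun P hP ↦ ⟨s P, ?_, hs P hP⟩
    · simpa using (Ideal.eq_top_iff_one _).mp this
    · simpa [Submodule.mem_colon_singleton] using hann P hP a (haM _)
  exact ⟨((Submodule.quotEquivOfEq _ _ hker).symm ≪≫ₗ
    LinearMap.quotKerEquivOfSurjective _ (by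
      rwa [← LinearMap.range_eq_top, LinearMap.range_toSpanSingleton])).symm⟩

/-- A nonzero conductor forces `x` to generate the extension of fraction fields. -/
theorem adjoin_algebraMap_eq_top_of_mem_conductor {F : Type*} [Field F] [NumberField F]
    {x s : 𝓞 F} (hs : s ∈ conductor ℤ x) (hs0 : s ≠ 0) :
    Algebra.adjoin ℚ {algebraMap (𝓞 F) F x} = ⊤ := by
  set A := Algebra.adjoin ℚ {algebraMap (𝓞 F) F x}
  have hA {b : 𝓞 F} (hb : b ∈ Algebra.adjoin ℤ {x}) : algebraMap (𝓞 F) F b ∈ A := by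
    rw [Algebra.adjoin_singleton_eq_range_aeval, AlgHom.mem_range] at hb
    obtain ⟨g, rfl⟩ := hb
    rw [← Polynomial.aeval_algebraMap_apply, ← Polynomial.aeval_map_algebraMap ℚ]
    exact Polynomial.aeval_mem_adjoin_singleton ℚ _
  have hinv {y : F} (hy : y ∈ A) : y⁻¹ ∈ A :=
    A.inv_mem_of_algebraic (x := ⟨y, hy⟩) (Algebra.IsAlgebraic.isAlgebraic _)
  have hO (b : 𝓞 F) : algebraMap (𝓞 F) F b ∈ A := by
    have h := mul_mem (hinv (hA (conductor_subset_adjoin hs))) (hA (mem_conductor_iff.mp hs b))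
    rwa [map_mul, inv_mul_cancel_left₀ (by simpa using hs0)] at h
  rw [eq_top_iff]
  intro y _
  obtain ⟨b, c, -, rfl⟩ := IsFractionRing.div_surjective (A := 𝓞 F) y
  rw [div_eq_mul_inv]
  exact mul_mem (hO b) (hinv (hO c))

/-- The differentials of a ring of integers are cyclic with annihilator the different ideal. -/
theorem nonempty_kaehlerDifferential_equiv_quotient_differentIdeal (F : Type*) [Field F]
    [NumberField F] : Nonempty (Ω[(𝓞 F)⁄ℤ] ≃ₗ[𝓞 F] 𝓞 F ⧸ differentIdeal ℤ (𝓞 F)) := by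
  have hfin : Module.Finite (𝓞 F) Ω[(𝓞 F)⁄ℤ] := inferInstance
  refine nonempty_linearEquiv_quotient_of_locally_cyclic differentIdeal_ne_bot fun P hP ↦ ?_
  have hP0 : P ≠ ⊥ := Ring.ne_bot_of_isMaximal_of_not_isField hP (RingOfIntegers.not_isField F)
  have hPfin : Finite (𝓞 F ⧸ P) := Ideal.finiteQuotientOfFreeOfNeBot P hP0
  obtain ⟨x, s, hs, hsP⟩ := exists_conductor_not_le (R := ℤ) P (a := Ideal.absNorm P)
    (by simpa [Ideal.absNorm_eq_zero_iff] using hP0) (by simpa using Ideal.absNorm_mem P)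
  have hx : IsIntegral ℤ x := Algebra.IsIntegral.isIntegral x
  have hs0 : s ≠ 0 := fun h ↦ hsP (h ▸ zero_mem P)
  have htop := adjoin_algebraMap_eq_top_of_mem_conductor hs hs0
  have hcond := conductor_mul_differentIdeal ℤ ℚ F x htop
  set δ := aeval x (derivative (minpoly ℤ x))
  have hδ : δ • KaehlerDifferential.D ℤ (𝓞 F) x = 0 := by
    rw [← Derivation.map_aeval, minpoly.aeval, map_zero]
  refine ⟨s ^ 3, fun h ↦ hsP (hP.isPrime.mem_of_pow_mem _ h), s • KaehlerDifferential.D ℤ (𝓞 F) x,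
    fun m ↦ ?_, fun a ha ↦ ?_, fun a ha ↦ ?_⟩
  · obtain ⟨b, hb⟩ := Submodule.mem_span_singleton.mp (smul_kaehlerDifferential_mem_span_D hs m)
    refine Submodule.mem_span_singleton.mpr ⟨s * b, ?_⟩
    rw [smul_comm, mul_smul, hb, ← mul_smul, ← mul_smul]
    ring_nf
  · obtain ⟨c, hc⟩ := Ideal.mem_span_singleton'.mp (hcond ▸ Ideal.mul_mem_mul hs ha)
    rw [← mul_smul, mul_comm a, ← hc, mul_smul, hδ, smul_zero]
  · have h := mul_sq_mem_span_of_smul_D_eq_zero hx hs ((mul_smul a s _).trans ha)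
    rw [← hcond] at h
    have : s ^ 3 * a = a * s * s ^ 2 := by ring
    rw [this]
    exact Ideal.mul_le_right h

/-- For a number field `F` with ring of integers `O_F` and discriminant `d_F`, the module
of Kähler differentials `Ω_{O_F/ℤ}` is a finite abelian group whose order is `|d_F|`. -/
theorem card_kaehlerDifferential_eq_natAbs_discr (F : Type) [Field F] [NumberField F] :
    Finite (Ω[(𝓞 F)⁄ℤ]) ∧ Nat.card (Ω[(𝓞 F)⁄ℤ]) = (NumberField.discr F).natAbs := by
  obtain ⟨e⟩ := nonempty_kaehlerDifferential_equiv_quotient_differentIdeal F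
  have : Finite (𝓞 F ⧸ differentIdeal ℤ (𝓞 F)) :=
    Ideal.finiteQuotientOfFreeOfNeBot _ differentIdeal_ne_bot
  refine ⟨Finite.of_equiv _ e.symm.toEquiv, ?_⟩
  rw [Nat.card_congr e.toEquiv, ← absNorm_differentIdeal F (𝓞 F)]
  rfl
end

section
/- Let R be a commutative ring and 0 → M' → M → M'' → 0 a short exact sequence of finitely generated projective R-modules. Then in the Grothendieck group K_0(R) (or in any λ-ring receiving the classes of projective modules), [Λ^n M] = Σ_{p+q=n} [Λ^p M'] · [Λ^q M''] for all n ≥ 0. -/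
open scoped TensorProduct

namespace ExteriorAlgebra

variable {R M N : Type*} [CommRing R] [AddCommGroup M] [Module R M] [AddCommGroup N] [Module R N]

variable (R M N) in
/-- The multiplication map `⋀M ⊗ ⋀N → ⋀(M × N)`, `x ⊗ y ↦ x ∧ y`. -/
noncomputable def tensorToProd :
    ExteriorAlgebra R M ⊗[R] ExteriorAlgebra R N →ₗ[R] ExteriorAlgebra R (M × N) :=
  LinearMap.mul' R _ ∘ₗ
    TensorProduct.map (map (LinearMap.inl R M N)).toLinearMap (map (LinearMap.inr R M N)).toLinearMap

theorem tensorToProd_tmul (x : ExteriorAlgebra R M) (y : ExteriorAlgebra R N) :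
    tensorToProd R M N (x ⊗ₜ y) = map (LinearMap.inl R M N) x * map (LinearMap.inr R M N) y := by
  simp [tensorToProd]

theorem tensorToProd_injective : Function.Injective (tensorToProd R M N) := by
  let Q₁ : QuadraticForm R M := 0
  let Q₂ : QuadraticForm R N := 0
  let i : (0 : QuadraticForm R (M × N)) →qᵢ Q₁.prod Q₂ :=
    { LinearMap.id with map_app' := fun _ => by simp [Q₁, Q₂] }
  let e : ExteriorAlgebra R (M × N) →ₐ[R] CliffordAlgebra (Q₁.prod Q₂) := CliffordAlgebra.map i
  have hl : e.comp (map (LinearMap.inl R M N)) = CliffordAlgebra.map (.inl Q₁ Q₂) :=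
    CliffordAlgebra.map_comp_map _ _
  have hr : e.comp (map (LinearMap.inr R M N)) = CliffordAlgebra.map (.inr Q₁ Q₂) :=
    CliffordAlgebra.map_comp_map _ _
  have key : e.toLinearMap ∘ₗ tensorToProd R M N =
      (CliffordAlgebra.toProd Q₁ Q₂).toLinearMap ∘ₗ
        (GradedTensorProduct.of R (CliffordAlgebra.evenOdd Q₁)
          (CliffordAlgebra.evenOdd Q₂)).toLinearMap := by
    refine TensorProduct.ext' fun x y => ?_
    have hx := DFunLike.congr_fun hl x
    have hy := DFunLike.congr_fun hr y
    simp only [AlgHom.comp_apply] at hx hy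
    simp only [LinearMap.comp_apply, AlgHom.toLinearMap_apply, tensorToProd_tmul, map_mul, hx, hy]
    exact (GradedTensorProduct.lift_tmul _ _ _ _ _ x y).symm
  have hinj : Function.Injective (e.toLinearMap ∘ₗ tensorToProd R M N) := by
    rw [key]
    exact (CliffordAlgebra.prodEquiv Q₁ Q₂).symm.injective.comp (LinearEquiv.injective _)
  exact Function.Injective.of_comp hinj

theorem exteriorPower_eq_map_pow (f : M →ₗ[R] N) (n : ℕ) :
    (⋀[R]^n M).map (map f).toLinearMap = ((LinearMap.range f).map (ι R)) ^ n := by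
  rw [exteriorPower, Submodule.map_pow, ι_range_map_map]

theorem commute_map_ι (p q : Submodule R M) : Commute (p.map (ι R)) (q.map (ι R)) := by
  have h (p q : Submodule R M) : p.map (ι R) * q.map (ι R) ≤ q.map (ι R) * p.map (ι R) := by
    rw [Submodule.mul_le]
    rintro _ ⟨x, hx, rfl⟩ _ ⟨y, hy, rfl⟩
    rw [eq_neg_of_add_eq_zero_left (ι_add_mul_swap x y)]
    exact neg_mem (Submodule.mul_mem_mul ⟨y, hy, rfl⟩ ⟨x, hx, rfl⟩)
  exact le_antisymm (h p q) (h q p)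

variable (R M N) in
theorem exteriorPower_prod_eq_iSup (n : ℕ) :
    ⋀[R]^n (M × N) = ⨆ p : Fin (n + 1),
      (⋀[R]^(p : ℕ) M).map (map (LinearMap.inl R M N)).toLinearMap *
        (⋀[R]^(n - p) N).map (map (LinearMap.inr R M N)).toLinearMap := by
  have hrange : LinearMap.range (ι R : M × N →ₗ[R] _) =
      (LinearMap.range (LinearMap.inl R M N)).map (ι R) +
        (LinearMap.range (LinearMap.inr R M N)).map (ι R) := by
    rw [Submodule.add_eq_sup, ← Submodule.map_sup, LinearMap.sup_range_inl_inr, Submodule.map_top]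
  simp only [exteriorPower_eq_map_pow]
  rw [exteriorPower, hrange, (commute_map_ι _ _).add_pow, ← Fin.sum_univ_eq_sum_range
    (fun p => _ ^ p * _ ^ (n - p) * ((n.choose p : ℕ) : Submodule R (ExteriorAlgebra R (M × N))))]
  rw [← Finset.sup_univ_eq_iSup]
  change _ = ∑ p : Fin (n + 1), _
  refine Finset.sum_congr rfl fun p _ => ?_
  rw [natCast_eq_one (Nat.choose_pos (Nat.lt_succ_iff.mp p.2)).ne', mul_one]

/-- The projection of the exterior algebra onto its part of degree `n`. -/
noncomputable def projPower (n : ℕ) : ExteriorAlgebra R M →ₗ[R] ⋀[R]^n M :=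
  DirectSum.component R ℕ (fun i => ⋀[R]^i M) n ∘ₗ
    (DirectSum.decomposeLinearEquiv (fun i => ⋀[R]^i M)).toLinearMap

theorem projPower_comp_subtype_same (n : ℕ) :
    projPower n ∘ₗ (⋀[R]^n M).subtype = LinearMap.id := by
  refine LinearMap.ext fun x => Subtype.ext ?_
  exact DirectSum.decompose_of_mem_same (fun i => ⋀[R]^i M) x.2

theorem projPower_comp_subtype_of_ne {m n : ℕ} (h : m ≠ n) :
    projPower n ∘ₗ (⋀[R]^m M).subtype = 0 := by
  refine LinearMap.ext fun x => Subtype.ext ?_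
  exact DirectSum.decompose_of_mem_ne (fun i => ⋀[R]^i M) x.2 h

end ExteriorAlgebra

namespace exteriorPower

open ExteriorAlgebra

variable {R M N : Type*} [CommRing R] [AddCommGroup M] [Module R M] [AddCommGroup N] [Module R N]

variable (R M N) in
/-- The inclusion of the part of total degree `n` in `⋀M ⊗ ⋀N`. -/
noncomputable def piTensorIncl (n : ℕ) :
    ((p : Fin (n + 1)) → ⋀[R]^(p : ℕ) M ⊗[R] ⋀[R]^(n - p) N) →ₗ[R]
      ExteriorAlgebra R M ⊗[R] ExteriorAlgebra R N :=
  LinearMap.lsum R (fun p : Fin (n + 1) => ⋀[R]^(p : ℕ) M ⊗[R] ⋀[R]^(n - p) N) R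
    fun p => TensorProduct.map (⋀[R]^(p : ℕ) M).subtype (⋀[R]^(n - p) N).subtype

theorem piTensorIncl_injective (n : ℕ) : Function.Injective (piTensorIncl R M N n) := by
  let r := LinearMap.pi fun p : Fin (n + 1) =>
    TensorProduct.map (projPower (R := R) (M := M) p) (projPower (R := R) (M := N) (n - p))
  refine Function.LeftInverse.injective (g := r) fun z => ?_
  suffices r ∘ₗ piTensorIncl R M N n = LinearMap.id from DFunLike.congr_fun this z
  refine LinearMap.pi_ext' fun p => LinearMap.ext fun t => funext fun q => ?_
  have : r (piTensorIncl R M N n (Pi.single p t)) q =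
      (TensorProduct.map (projPower (R := R) (M := M) q ∘ₗ (⋀[R]^(p : ℕ) M).subtype)
        (projPower (R := R) (M := N) (n - q) ∘ₗ (⋀[R]^(n - p) N).subtype)) t := by
    rw [piTensorIncl, LinearMap.lsum_piSingle, TensorProduct.map_comp]
    rfl
  refine this.trans ?_
  obtain rfl | hpq := eq_or_ne p q
  · simp [projPower_comp_subtype_same]
  · simp [projPower_comp_subtype_of_ne (Fin.val_ne_of_ne hpq), hpq.symm]

theorem range_tensorToProd_comp_piTensorIncl (n : ℕ) :
    LinearMap.range (tensorToProd R M N ∘ₗ piTensorIncl R M N n) = ⋀[R]^n (M × N) := by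
  rw [exteriorPower_prod_eq_iSup, piTensorIncl, LinearMap.range_eq_map,
    ← LinearMap.iSup_range_single, Submodule.map_iSup]
  refine iSup_congr fun p => ?_
  rw [← LinearMap.range_comp]
  apply le_antisymm
  · rintro _ ⟨t, rfl⟩
    rw [LinearMap.comp_apply, LinearMap.comp_apply, LinearMap.single_apply, LinearMap.lsum_piSingle]
    induction t with
    | zero => simp
    | add x y hx hy => simpa only [map_add] using add_mem hx hy
    | tmul x y =>
      rw [TensorProduct.map_tmul, tensorToProd_tmul]
      exact Submodule.mul_mem_mul ⟨_, x.2, rfl⟩ ⟨_, y.2, rfl⟩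
  · rw [Submodule.mul_le]
    rintro _ ⟨x, hx, rfl⟩ _ ⟨y, hy, rfl⟩
    refine ⟨⟨x, hx⟩ ⊗ₜ ⟨y, hy⟩, ?_⟩
    rw [LinearMap.comp_apply, LinearMap.comp_apply, LinearMap.single_apply,
      LinearMap.lsum_piSingle, TensorProduct.map_tmul, tensorToProd_tmul]
    rfl

variable (R M N) in
/-- The decomposition `⋀ⁿ(M × N) ≃ ∏_{p ≤ n} ⋀ᵖ M ⊗ ⋀ⁿ⁻ᵖ N`. -/
noncomputable def prodEquivPi (n : ℕ) :
    ⋀[R]^n (M × N) ≃ₗ[R] ((p : Fin (n + 1)) → ⋀[R]^(p : ℕ) M ⊗[R] ⋀[R]^(n - p) N) :=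
  ((LinearEquiv.ofInjective (tensorToProd R M N ∘ₗ piTensorIncl R M N n)
    (tensorToProd_injective.comp (piTensorIncl_injective n))).trans
    (LinearEquiv.ofEq _ _ (range_tensorToProd_comp_piTensorIncl n))).symm

/-- A linear equivalence induces one on exterior powers. -/
noncomputable def congr (e : M ≃ₗ[R] N) (n : ℕ) : ⋀[R]^n M ≃ₗ[R] ⋀[R]^n N :=
  LinearEquiv.ofLinearMap (map n e.toLinearMap) (map n e.symm.toLinearMap)
    (by rw [← map_comp]; simp) (by rw [← map_comp]; simp)

instance instProjective [Module.Projective R M] (n : ℕ) : Module.Projective R (⋀[R]^n M) := by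
  obtain ⟨s, hs⟩ := Module.projective_def'.mp ‹Module.Projective R M›
  refine .of_split (map n s) (map n (Finsupp.linearCombination R id)) ?_
  rw [← map_comp, hs, map_id]

end exteriorPower

/-- An invariant that is additive on short exact sequences of finitely generated projective modules
takes finite products of such modules to sums. -/
theorem class_pi_eq_sum {R A : Type} [CommRing R] [CommRing A]
    (cl : (N : Type) → [AddCommGroup N] → [Module R N] → A)
    (h_iso : ∀ (N₁ N₂ : Type) [AddCommGroup N₁] [Module R N₁] [AddCommGroup N₂] [Module R N₂],
      (N₁ ≃ₗ[R] N₂) → cl N₁ = cl N₂)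
    (h_add : ∀ (N₁ N₂ N₃ : Type) [AddCommGroup N₁] [Module R N₁] [AddCommGroup N₂] [Module R N₂]
      [AddCommGroup N₃] [Module R N₃]
      [Module.Projective R N₁] [Module.Finite R N₁] [Module.Projective R N₂] [Module.Finite R N₂]
      [Module.Projective R N₃] [Module.Finite R N₃]
      (u : N₁ →ₗ[R] N₂) (v : N₂ →ₗ[R] N₃),
      Function.Injective u → Function.Surjective v → Function.Exact u v →
        cl N₂ = cl N₁ + cl N₃)
    (k : ℕ) (P : Fin k → Type) [∀ i, AddCommGroup (P i)] [∀ i, Module R (P i)]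
    [∀ i, Module.Projective R (P i)] [∀ i, Module.Finite R (P i)] :
    cl ((i : Fin k) → P i) = ∑ i, cl (P i) := by
  have h_prod (N₁ N₂ : Type) [AddCommGroup N₁] [Module R N₁] [AddCommGroup N₂] [Module R N₂]
      [Module.Projective R N₁] [Module.Finite R N₁] [Module.Projective R N₂]
      [Module.Finite R N₂] : cl (N₁ × N₂) = cl N₁ + cl N₂ :=
    h_add _ _ _ (LinearMap.inl R N₁ N₂) (LinearMap.snd R N₁ N₂) LinearMap.inl_injective
      LinearMap.snd_surjective .inl_snd
  induction k with
  | zero =>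
    have h := h_prod ((i : Fin 0) → P i) ((i : Fin 0) → P i)
    rw [h_iso _ ((i : Fin 0) → P i) 0] at h
    simpa using h
  | succ k ih =>
    have : Module.Projective R ((i : Fin k) → P i.succ) :=
      .of_equiv DFinsupp.linearEquivFunOnFintype
    rw [h_iso _ _ (Fin.consLinearEquiv R P).symm, h_prod, ih, Fin.sum_univ_succ]

/-- In the Grothendieck group `K₀(R)` (formalized as: for any additive, tensor-multiplicative,
isomorphism-invariant assignment of classes in a commutative ring to finitely generated
projective modules), a short exact sequence `0 → M' → M → M'' → 0` of finitely generated
projective modules yields `[Λ^n M] = Σ_{p+q=n} [Λ^p M']·[Λ^q M'']` for all `n ≥ 0`. -/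
theorem exteriorPower_class_formula {R : Type} [CommRing R] {A : Type} [CommRing A]
    (cl : (N : Type) → [inst : AddCommGroup N] → [inst2 : Module R N] → A)
    (h_iso : ∀ (N₁ N₂ : Type) [AddCommGroup N₁] [Module R N₁] [AddCommGroup N₂] [Module R N₂],
      (N₁ ≃ₗ[R] N₂) → cl N₁ = cl N₂)
    (h_add : ∀ (N₁ N₂ N₃ : Type) [AddCommGroup N₁] [Module R N₁] [AddCommGroup N₂] [Module R N₂]
      [AddCommGroup N₃] [Module R N₃]
      [Module.Projective R N₁] [Module.Finite R N₁] [Module.Projective R N₂] [Module.Finite R N₂]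
      [Module.Projective R N₃] [Module.Finite R N₃]
      (u : N₁ →ₗ[R] N₂) (v : N₂ →ₗ[R] N₃),
      Function.Injective u → Function.Surjective v → Function.Exact u v →
        cl N₂ = cl N₁ + cl N₃)
    (h_mul : ∀ (N₁ N₂ : Type) [AddCommGroup N₁] [Module R N₁] [AddCommGroup N₂] [Module R N₂],
      cl (N₁ ⊗[R] N₂) = cl N₁ * cl N₂)
    {M' M M'' : Type} [AddCommGroup M'] [Module R M'] [AddCommGroup M] [Module R M]
    [AddCommGroup M''] [Module R M'']
    [Module.Projective R M'] [Module.Finite R M']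
    [Module.Projective R M] [Module.Finite R M]
    [Module.Projective R M''] [Module.Finite R M'']
    (f : M' →ₗ[R] M) (g : M →ₗ[R] M'')
    (hf : Function.Injective f) (hg : Function.Surjective g) (hfg : Function.Exact f g)
    (n : ℕ) :
    cl (⋀[R]^n M) = ∑ p ∈ Finset.range (n + 1), cl (⋀[R]^p M') * cl (⋀[R]^(n - p) M'') := by
  obtain ⟨s, hs⟩ := g.exists_rightInverse_of_surjective (LinearMap.range_eq_top.mpr hg)
  let e := (hfg.splitSurjectiveEquiv hf ⟨s, hs⟩).1
  rw [h_iso _ _ (exteriorPower.congr e n),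
    h_iso _ ((p : Fin (n + 1)) → ⋀[R]^(p : ℕ) M' ⊗[R] ⋀[R]^(n - p) M'')
      (exteriorPower.prodEquivPi R M' M'' n),
    class_pi_eq_sum cl h_iso h_add,
    ← Fin.sum_univ_eq_sum_range (fun p => cl (⋀[R]^p M') * cl (⋀[R]^(n - p) M''))]
  exact Finset.sum_congr rfl fun p _ => h_mul _ _
end
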